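/- For mutually absolutely continuous probability measures μ_0, μ_1 on X, any minimizer ν of max{KL(ν, μ_0), KL(ν, μ_1)} over probability measures ν must satisfy KL(ν, μ_0) = KL(ν, μ_1), provided the minimum is attained at some ν with both divergences finite and μ_0 ≠ μ_1. -/

import Mathlib

open MeasureTheory
open scoped Classical

/-- Kullback–Leibler divergence: `∫ log (dν/dμ) dν` when `ν ≪ μ` and the integral is
well-defined, and `+∞` otherwise. -/
noncomputable def KL {X : Type*} [MeasurableSpace X] (ν μ : Measure X) : ENNReal :=
  if ν ≪ μ ∧ Integrable (fun x => Real.log ((ν.rnDeriv μ x).toReal)) ν then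
    ENNReal.ofReal (∫ x, Real.log ((ν.rnDeriv μ x).toReal) ∂ν)
  else ⊤

open scoped ENNReal NNReal in
open InformationTheory ENNReal in
lemma KL_eq_klDiv {X : Type*} [MeasurableSpace X] (ν μ : Measure X)
    [IsProbabilityMeasure ν] [IsProbabilityMeasure μ] : KL ν μ = klDiv ν μ := by
  rw [klDiv_def]
  unfold KL
  have : (fun x => Real.log ((ν.rnDeriv μ x).toReal)) = llr ν μ := rfl
  rw [this]
  simp

open scoped ENNReal NNReal in
open InformationTheory ENNReal NNReal in
lemma klDiv_convex {X : Type*} [MeasurableSpace X] (ν ρ μ : Measure X)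
    [IsProbabilityMeasure ν] [IsProbabilityMeasure ρ] [IsProbabilityMeasure μ]
    (hν : ν ≪ μ) (hρ : ρ ≪ μ) (a b : ℝ≥0) (hab : a + b = 1) :
    klDiv (a • ν + b • ρ) μ ≤ a * klDiv ν μ + b * klDiv ρ μ := by
  have hac : a • ν + b • ρ ≪ μ := by
    refine Measure.AbsolutelyContinuous.add_left ?_ ?_
    · exact hν.smul_left a
    · exact hρ.smul_left b
  rw [klDiv_eq_lintegral_klFun_of_ac hν, klDiv_eq_lintegral_klFun_of_ac hρ,
    klDiv_eq_lintegral_klFun_of_ac hac, ← lintegral_const_mul _ (by fun_prop),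
    ← lintegral_const_mul _ (by fun_prop), ← lintegral_add_left (by fun_prop)]
  apply lintegral_mono_ae
  filter_upwards [Measure.rnDeriv_add (a • ν) (b • ρ) μ, Measure.rnDeriv_smul_left ν μ a,
    Measure.rnDeriv_smul_left ρ μ b, Measure.rnDeriv_ne_top ν μ, Measure.rnDeriv_ne_top ρ μ]
    with x h1 h2 h3 h4 h5
  rw [h1, Pi.add_apply, h2, h3, Pi.smul_apply, Pi.smul_apply]
  have e : (a • ν.rnDeriv μ x + b • ρ.rnDeriv μ x).toReal
      = (a:ℝ) • (ν.rnDeriv μ x).toReal + (b:ℝ) • (ρ.rnDeriv μ x).toReal := by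
    rw [ENNReal.toReal_add]
    · simp [ENNReal.smul_def]
    · exact ENNReal.mul_ne_top (by simp) h4
    · exact ENNReal.mul_ne_top (by simp) h5
  rw [e]
  have := convexOn_klFun.2 (x := (ν.rnDeriv μ x).toReal) (by simp)
    (y := (ρ.rnDeriv μ x).toReal) (by simp) a.coe_nonneg b.coe_nonneg
    (by rw [← NNReal.coe_add, hab, NNReal.coe_one])
  refine (ENNReal.ofReal_le_ofReal this).trans ?_
  rw [ENNReal.ofReal_add, smul_eq_mul, smul_eq_mul, ENNReal.ofReal_mul a.coe_nonneg,
    ENNReal.ofReal_mul b.coe_nonneg]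
  · simp
  · exact mul_nonneg a.coe_nonneg (klFun_nonneg (by simp))
  · exact mul_nonneg b.coe_nonneg (klFun_nonneg (by simp))

open scoped ENNReal NNReal in
open InformationTheory ENNReal NNReal in
/-- bounded density gives finite divergence, at most log of the bound -/
lemma klDiv_bdd {X : Type*} [MeasurableSpace X] (ρ μ : Measure X)
    [IsProbabilityMeasure ρ] [IsProbabilityMeasure μ]
    (hρ : ρ ≪ μ) (c : ℝ) (hc : ∀ᵐ x ∂μ, (ρ.rnDeriv μ x).toReal ≤ c) :
    klDiv ρ μ ≤ ENNReal.ofReal (Real.log c) := by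
  have hfin : klDiv ρ μ ≠ ∞ := by
    rw [klDiv_eq_lintegral_klFun_of_ac hρ]
    have : ∫⁻ x, ENNReal.ofReal (klFun (ρ.rnDeriv μ x).toReal) ∂μ
        ≤ ∫⁻ x, ENNReal.ofReal (c^2+1) ∂μ := by
      apply lintegral_mono_ae
      filter_upwards [hc] with x hx
      apply ENNReal.ofReal_le_ofReal
      have h0 : 0 ≤ (ρ.rnDeriv μ x).toReal := by simp
      set y := (ρ.rnDeriv μ x).toReal
      rw [klFun_apply]
      have := mul_le_mul_of_nonneg_left (Real.log_le_self h0) h0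
      nlinarith
    refine ne_top_of_le_ne_top ?_ this
    simp
  have hint := (klDiv_ne_top_iff.1 hfin).2
  rw [← ENNReal.ofReal_toReal hfin]
  apply ENNReal.ofReal_le_ofReal
  rw [toReal_klDiv_of_measure_eq hρ (by simp)]
  have : ∫ x, llr ρ μ x ∂ρ ≤ ∫ x, Real.log c ∂ρ := by
    apply integral_mono_ae hint (integrable_const _)
    filter_upwards [hρ.ae_le hc, Measure.rnDeriv_pos hρ, hρ.ae_le (Measure.rnDeriv_ne_top ρ μ)]
      with x hx hp ht
    exact Real.log_le_log (ENNReal.toReal_pos hp.ne' ht) hx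
  simpa using this

open scoped ENNReal NNReal in
open InformationTheory ENNReal NNReal ProbabilityTheory Filter Topology in
lemma exists_approx {X : Type*} [MeasurableSpace X] (μ0 μ1 : Measure X)
    [IsProbabilityMeasure μ0] [IsProbabilityMeasure μ1]
    (h01 : μ0 ≪ μ1) (ε : ℝ≥0∞) (hε : 0 < ε) :
    ∃ ρ : Measure X, IsProbabilityMeasure ρ ∧ ρ ≪ μ0 ∧ klDiv ρ μ0 < ε ∧ klDiv ρ μ1 ≠ ∞ := by
  let A : ℕ → Set X := fun n => {x | μ0.rnDeriv μ1 x ≤ n}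
  have hA : ∀ n, MeasurableSet (A n) := fun n =>
    measurableSet_le (Measure.measurable_rnDeriv _ _) measurable_const
  have hmono : Monotone A := fun n m h x hx => le_trans (show _ ≤ (n:ℝ≥0∞) from hx)
    (by exact_mod_cast h)
  have hU : μ0 (⋃ n, A n) = 1 := by
    rw [prob_compl_eq_zero_iff (MeasurableSet.iUnion hA) |>.symm]
    refine measure_mono_null ?_ (h01.ae_le (Measure.rnDeriv_ne_top μ0 μ1))
    intro x hx hx'
    apply hx
    obtain ⟨n, hn⟩ := ENNReal.exists_nat_gt hx'
    exact Set.mem_iUnion.2 ⟨n, hn.le⟩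
  have ht := tendsto_measure_iUnion_atTop (μ := μ0) hmono
  rw [hU] at ht
  have ht1 : Tendsto (fun n => ((μ0 (A n))⁻¹).toReal) atTop (𝓝 1) := by
    have := (ENNReal.tendsto_toReal (a := 1⁻¹) (by simp)).comp (ht.inv)
    simpa [Function.comp_def] using this
  have ht2 : Tendsto (fun n => ENNReal.ofReal (Real.log ((μ0 (A n))⁻¹).toReal)) atTop (𝓝 0) := by
    have := ENNReal.tendsto_ofReal (ht1.log (by simp))
    simpa using this
  have hpos : ∀ᶠ n in atTop, 0 < μ0 (A n) := ht.eventually (lt_mem_nhds (by simp))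
  obtain ⟨n, hn1, hn2⟩ := (hpos.and (ht2.eventually (gt_mem_nhds hε))).exists
  have hc : (μ0 (A n))⁻¹ ≠ ∞ := by simpa using hn1.ne'
  have hprob : IsProbabilityMeasure (μ0[|A n]) := cond_isProbabilityMeasure hn1.ne'
  have hac : μ0[|A n] ≪ μ0 := cond_absolutelyContinuous
  have hmeas : ∀ μ : Measure X, IsProbabilityMeasure μ → μ0 ≪ μ →
      (μ0[|A n]).rnDeriv μ =ᵐ[μ] fun x => (μ0 (A n))⁻¹ * (A n).indicator (μ0.rnDeriv μ) x := by
    intro μ _ h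
    have h1 := Measure.rnDeriv_smul_left_of_ne_top (μ0.restrict (A n)) μ hc
    have h2 := Measure.rnDeriv_restrict μ0 μ (hA n)
    filter_upwards [h1, h2] with x h1 h2
    unfold ProbabilityTheory.cond
    rw [h1, Pi.smul_apply, h2, smul_eq_mul]
  refine ⟨μ0[|A n], hprob, hac, lt_of_le_of_lt (klDiv_bdd _ _ hac _ ?_) hn2, ?_⟩
  · filter_upwards [hmeas μ0 inferInstance Measure.AbsolutelyContinuous.rfl,
      Measure.rnDeriv_self μ0] with x h1 h2
    rw [h1]
    apply ENNReal.toReal_mono hc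
    by_cases hx : x ∈ A n <;> simp [hx, h2]
  · refine ne_top_of_le_ne_top (by simp) (klDiv_bdd _ _ (hac.trans h01)
      ((μ0 (A n))⁻¹ * n).toReal ?_)
    filter_upwards [hmeas μ1 inferInstance h01] with x h1
    rw [h1]
    apply ENNReal.toReal_mono (ENNReal.mul_ne_top hc (by simp))
    gcongr
    by_cases hx : x ∈ A n
    · rw [Set.indicator_of_mem hx]
      exact hx
    · simp [hx]

open scoped ENNReal NNReal in
open InformationTheory ENNReal NNReal in
lemma not_lt_aux {X : Type*} [MeasurableSpace X]
    (μ0 μ1 ν : Measure X)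
    [IsProbabilityMeasure μ0] [IsProbabilityMeasure μ1] [IsProbabilityMeasure ν]
    (h01 : μ0 ≪ μ1)
    (hf0 : klDiv ν μ0 ≠ ⊤) (hf1 : klDiv ν μ1 ≠ ⊤)
    (hlt : klDiv ν μ1 < klDiv ν μ0) :
    ∃ ν' : Measure X, IsProbabilityMeasure ν' ∧
      max (klDiv ν' μ0) (klDiv ν' μ1) < klDiv ν μ0 := by
  obtain ⟨ρ, hρ, hac, hk, hk1⟩ := exists_approx μ0 μ1 h01 _ (bot_le.trans_lt hlt)
  have c0 := fun a b => klDiv_convex ν ρ μ0 (klDiv_ne_top_iff.1 hf0).1 hac a b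
  have c1 := fun a b => klDiv_convex ν ρ μ1 (klDiv_ne_top_iff.1 hf1).1 (hac.trans h01) a b
  have hk0 := hk.ne_top
  generalize klDiv ν μ0 = K0 at *
  generalize klDiv ν μ1 = K1 at *
  generalize klDiv ρ μ0 = L0 at *
  generalize klDiv ρ μ1 = L1 at *
  lift K0 to ℝ≥0 using hf0
  lift K1 to ℝ≥0 using hf1
  lift L0 to ℝ≥0 using hk0
  lift L1 to ℝ≥0 using hk1
  have hlt' : (K1:ℝ) < K0 := by exact_mod_cast hlt
  have hk' : (L0:ℝ) < K0 := by exact_mod_cast hk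
  obtain ⟨a, b, hab, hb, hL⟩ : ∃ a b : ℝ≥0, a + b = 1 ∧ 0 < b ∧ (K1 + b * L1 : ℝ) < K0 := by
    have hL1 : (0:ℝ) ≤ L1 := L1.2
    have hd : (0:ℝ) < K0 - K1 := by linarith
    have hD : (0:ℝ) < (K0 - K1) + L1 + 1 := by linarith
    have ht : (0:ℝ) < (K0 - K1) / ((K0 - K1) + L1 + 1) := div_pos hd hD
    have ht1 : (K0 - K1) / ((K0 - K1) + L1 + 1) ≤ (1:ℝ) := by
      rw [div_le_one hD]; linarith
    have ht2 : (K0 - K1) / ((K0 - K1) + L1 + 1) * L1 < (K0 - K1 : ℝ) := by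
      rw [div_mul_eq_mul_div, div_lt_iff₀ hD]
      nlinarith
    generalize (K0 - K1 : ℝ) / ((K0 - K1) + L1 + 1) = t at ht ht1 ht2
    lift t to ℝ≥0 using ht.le
    have ht1' : t ≤ 1 := by exact_mod_cast ht1
    exact ⟨1 - t, t, tsub_add_cancel_of_le ht1', by exact_mod_cast ht, by linarith⟩
  have hab' : (a + b : ℝ) = 1 := by exact_mod_cast hab
  have hb' : (0:ℝ) < b := by exact_mod_cast hb
  have ha' : (0:ℝ) ≤ a := a.2
  refine ⟨a • ν + b • ρ, ⟨?_⟩, max_lt ((c0 a b hab).trans_lt ?_) ((c1 a b hab).trans_lt ?_)⟩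
  · simp only [Measure.add_apply, Measure.smul_apply, measure_univ, ENNReal.smul_def, smul_eq_mul,
      mul_one]
    exact_mod_cast hab
  · norm_cast
    rw [← NNReal.coe_lt_coe]
    push_cast
    nlinarith
  · norm_cast
    rw [← NNReal.coe_lt_coe]
    push_cast
    have : (0:ℝ) ≤ K1 := K1.2
    nlinarith

/-- Any minimizer `ν` of `max {KL(ν, μ0), KL(ν, μ1)}` over probability measures, with both
divergences finite and `μ0 ≠ μ1` mutually absolutely continuous, must equalize the two
divergences. -/
theorem stmt2 {X : Type*} [MeasurableSpace X]
    (μ0 μ1 ν : Measure X)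
    [IsProbabilityMeasure μ0] [IsProbabilityMeasure μ1] [IsProbabilityMeasure ν]
    (h01 : μ0 ≪ μ1) (h10 : μ1 ≪ μ0) (hne : μ0 ≠ μ1)
    (hf0 : KL ν μ0 ≠ ⊤) (hf1 : KL ν μ1 ≠ ⊤)
    (hmin : ∀ ν' : Measure X, IsProbabilityMeasure ν' →
      max (KL ν μ0) (KL ν μ1) ≤ max (KL ν' μ0) (KL ν' μ1)) :
    KL ν μ0 = KL ν μ1 := by
  rw [KL_eq_klDiv] at hf0 hf1
  have key : ∀ ν' : Measure X, IsProbabilityMeasure ν' →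
      max (InformationTheory.klDiv ν μ0) (InformationTheory.klDiv ν μ1)
        ≤ max (InformationTheory.klDiv ν' μ0) (InformationTheory.klDiv ν' μ1) := by
    intro ν' h
    simpa only [KL_eq_klDiv] using hmin ν' h
  rw [KL_eq_klDiv, KL_eq_klDiv]
  rcases lt_trichotomy (InformationTheory.klDiv ν μ0) (InformationTheory.klDiv ν μ1)
    with h | h | h
  · obtain ⟨ν', hp, hl⟩ := not_lt_aux μ1 μ0 ν h10 hf1 hf0 h
    rw [max_comm] at hl
    exact absurd hl (not_lt.2 ((le_max_right _ _).trans (key ν' hp)))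
  · exact h
  · obtain ⟨ν', hp, hl⟩ := not_lt_aux μ0 μ1 ν h01 hf0 hf1 h
    exact absurd hl (not_lt.2 ((le_max_left _ _).trans (key ν' hp)))
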